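/- For any digraph G, the weight w(G) computed as the gcd of σ(R) over all closed routes R with positive weight equals the gcd of σ(R) over all closed unrepeated routes R with positive weight (closed routes whose vertices are pairwise distinct except the endpoints). -/

import Mathlib

/-- A route in a digraph `(V, E)` starting at a vertex `u` is encoded by a list of
steps `(s, w)` where `s = 1` means the edge is traversed forwards into `w` and
`s = -1` means it is traversed backwards. -/
def IsRoute {V : Type*} (E : V → V → Prop) : V → List (ℤ × V) → Prop
  | _, [] => True
  | u, (s, w) :: t => ((s = 1 ∧ E u w) ∨ (s = -1 ∧ E w u)) ∧ IsRoute E w t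

/-- The final vertex of a route starting at `u` with step list `l`. -/
def routeEnd {V : Type*} : V → List (ℤ × V) → V
  | u, [] => u
  | _, (_, w) :: t => routeEnd w t

/-- The weight `σ(R)` of a route: the sum of its signs. -/
def routeWeight {V : Type*} (l : List (ℤ × V)) : ℤ := (l.map Prod.fst).sum

/-- A digraph homomorphism maps arcs to arcs. -/
def IsDigraphHom {V₁ V₂ : Type*} (E₁ : V₁ → V₁ → Prop) (E₂ : V₂ → V₂ → Prop)
    (φ : V₁ → V₂) : Prop :=
  ∀ u v, E₁ u v → E₂ (φ u) (φ v)

/-- The set `W` of positive weights of closed routes in the digraph `(V, E)`. -/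
def closedWeights {V : Type*} (E : V → V → Prop) : Set ℤ :=
  {n : ℤ | 0 < n ∧ ∃ (u : V) (l : List (ℤ × V)),
    IsRoute E u l ∧ routeEnd u l = u ∧ routeWeight l = n}

/-- `g` is the greatest common divisor of the set `S ⊆ ℤ` (with the convention
`gcd ∅ = 0`). -/
def IsSetGcd (S : Set ℤ) (g : ℤ) : Prop :=
  0 ≤ g ∧ (∀ n ∈ S, g ∣ n) ∧ ∀ d : ℤ, (∀ n ∈ S, d ∣ n) → d ∣ g

/-- Weak connectedness: any two vertices are joined by a route. -/
def WeaklyConnected {V : Type*} (E : V → V → Prop) : Prop :=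
  ∀ u v : V, ∃ l : List (ℤ × V), IsRoute E u l ∧ routeEnd u l = v

/-- Arc relation of the directed cycle `Cₙ` on `ZMod n`. -/
def cycleRel (n : ℕ) : ZMod n → ZMod n → Prop := fun i j => j = i + 1

/-- Arc relation of the directed path with vertex set `Fin n`. -/
def pathRel (n : ℕ) : Fin n → Fin n → Prop := fun i j => (i : ℕ) + 1 = (j : ℕ)

/-- A closed route is unrepeated if its vertices are pairwise distinct except for
the coinciding endpoints. -/
def Unrepeated {V : Type*} (u : V) (l : List (ℤ × V)) : Prop :=
  (u :: (l.map Prod.snd).dropLast).Nodup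

/-- The set of positive weights of closed unrepeated routes in `(V, E)`. -/
def closedUnrepeatedWeights {V : Type*} (E : V → V → Prop) : Set ℤ :=
  {n : ℤ | 0 < n ∧ ∃ (u : V) (l : List (ℤ × V)),
    IsRoute E u l ∧ routeEnd u l = u ∧ Unrepeated u l ∧ routeWeight l = n}

section Routes

variable {V : Type*} {E : V → V → Prop}

theorem isRoute_append (u : V) (a b : List (ℤ × V)) :
    IsRoute E u (a ++ b) ↔ IsRoute E u a ∧ IsRoute E (routeEnd u a) b := by
  induction a generalizing u with
  | nil => simp [IsRoute, routeEnd]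
  | cons p t ih => simp [IsRoute, routeEnd, ih, and_assoc]

theorem routeEnd_append (u : V) (a b : List (ℤ × V)) :
    routeEnd u (a ++ b) = routeEnd (routeEnd u a) b := by
  induction a generalizing u with
  | nil => rfl
  | cons p t ih => simp [routeEnd, ih]

theorem routeWeight_append (a b : List (ℤ × V)) :
    routeWeight (a ++ b) = routeWeight a + routeWeight b := by
  simp [routeWeight]

theorem getElem_cons_map_snd (u : V) (l : List (ℤ × V)) (k : ℕ)
    (hk : k < (u :: l.map Prod.snd).length) :
    (u :: l.map Prod.snd)[k] = routeEnd u (l.take k) := by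
  induction l generalizing u k with
  | nil =>
    obtain rfl : k = 0 := by simpa using hk
    rfl
  | cons p t ih =>
    cases k with
    | zero => rfl
    | succ k => simpa [routeEnd] using ih p.2 k (by simpa using hk)

/-- The steps of a route starting at `u`, traversed in the opposite direction. -/
def routeReverse : V → List (ℤ × V) → List (ℤ × V)
  | _, [] => []
  | u, (s, w) :: t => routeReverse w t ++ [(-s, u)]

theorem routeEnd_routeReverse (u : V) (l : List (ℤ × V)) :
    routeEnd (routeEnd u l) (routeReverse u l) = u := by
  cases l with
  | nil => rfl
  | cons p t => simp [routeReverse, routeEnd_append, routeEnd]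

theorem IsRoute.routeReverse {u : V} {l : List (ℤ × V)} (h : IsRoute E u l) :
    IsRoute E (routeEnd u l) (routeReverse u l) := by
  induction l generalizing u with
  | nil => trivial
  | cons p t ih =>
    obtain ⟨s, w⟩ := p
    obtain ⟨hs, ht⟩ := h
    refine (isRoute_append _ _ _).2 ⟨ih ht, ?_⟩
    simp only [routeEnd, routeEnd_routeReverse, IsRoute, and_true]
    rcases hs with ⟨rfl, h⟩ | ⟨rfl, h⟩
    · exact Or.inr ⟨rfl, h⟩
    · exact Or.inl ⟨by norm_num, h⟩

theorem routeWeight_routeReverse (u : V) (l : List (ℤ × V)) :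
    routeWeight (routeReverse u l) = -routeWeight l := by
  induction l generalizing u with
  | nil => simp [routeReverse, routeWeight]
  | cons p t ih =>
    rw [routeReverse, routeWeight_append, ih]
    simp [routeWeight]

theorem map_snd_routeReverse (u : V) (l : List (ℤ × V)) :
    (routeReverse u l).map Prod.snd = ((u :: l.map Prod.snd).dropLast).reverse := by
  induction l generalizing u with
  | nil => rfl
  | cons p t ih => simp [routeReverse, ih]

theorem Unrepeated.routeReverse {u : V} {l : List (ℤ × V)} (h : Unrepeated u l) :
    Unrepeated u (routeReverse u l) := by
  cases l with
  | nil => exact h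
  | cons p t =>
    unfold Unrepeated at h ⊢
    rw [map_snd_routeReverse]
    simpa using h

/-- A closed route with a repeated vertex splits off a shorter closed route. -/
theorem exists_closed_split_of_not_unrepeated {u : V} {l : List (ℤ × V)}
    (h : ¬ Unrepeated u l) :
    ∃ a b c : List (ℤ × V), l = a ++ b ++ c ∧ b ≠ [] ∧ c ≠ [] ∧
      routeEnd (routeEnd u a) b = routeEnd u a := by
  have hl : l ≠ [] := by
    rintro rfl
    simp [Unrepeated] at h
  have hdrop : u :: (l.map Prod.snd).dropLast = (u :: l.map Prod.snd).dropLast := by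
    rw [List.dropLast_cons_of_ne_nil (by simpa using hl)]
  rw [Unrepeated, hdrop, List.nodup_iff_pairwise_ne, List.pairwise_iff_getElem] at h
  push Not at h
  obtain ⟨i, j, hi, hj, hij, heq⟩ := h
  rw [List.getElem_dropLast, List.getElem_dropLast, getElem_cons_map_snd,
    getElem_cons_map_snd] at heq
  have hj' : j < l.length := by simpa using hj
  have hsplit : l.take j = l.take i ++ (l.take j).drop i := by
    conv_lhs => rw [← List.take_append_drop i (l.take j)]
    rw [List.take_take, min_eq_left hij.le]
  refine ⟨l.take i, (l.take j).drop i, l.drop j, ?_, ?_, ?_, ?_⟩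
  · rw [← hsplit, List.take_append_drop]
  · apply List.ne_nil_of_length_pos
    simp only [List.length_drop, List.length_take]
    omega
  · apply List.ne_nil_of_length_pos
    simp only [List.length_drop]
    omega
  · rw [← routeEnd_append, ← hsplit, heq]

theorem dvd_routeWeight_of_dvd_unrepeated {d : ℤ}
    (hd : ∀ n ∈ closedUnrepeatedWeights E, d ∣ n) (u : V) (l : List (ℤ × V))
    (hr : IsRoute E u l) (hc : routeEnd u l = u) : d ∣ routeWeight l := by
  induction hn : l.length using Nat.strong_induction_on generalizing u l with
  | _ n ih =>
  subst hn
  by_cases hu : Unrepeated u l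
  · rcases lt_trichotomy (routeWeight l) 0 with hneg | hzero | hpos
    · rw [← dvd_neg]
      have hend := routeEnd_routeReverse u l
      have hrev := hr.routeReverse
      rw [hc] at hend hrev
      exact hd _ ⟨neg_pos.2 hneg, u, routeReverse u l, hrev, hend, hu.routeReverse,
        routeWeight_routeReverse u l⟩
    · simp [hzero]
    · exact hd _ ⟨hpos, u, l, hr, hc, hu, rfl⟩
  · obtain ⟨a, b, c, rfl, hb, hcn, hclosed⟩ := exists_closed_split_of_not_unrepeated hu
    have hb' := List.length_pos_of_ne_nil hb
    have hc' := List.length_pos_of_ne_nil hcn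
    simp only [isRoute_append, routeEnd_append, hclosed] at hr hc
    have h₁ := ih b.length (by simp; omega) _ b hr.1.2 hclosed rfl
    have h₂ := ih (a ++ c).length (by simp; omega) u (a ++ c)
      ((isRoute_append _ _ _).2 ⟨hr.1.1, hr.2⟩) (by rw [routeEnd_append, hc]) rfl
    rw [routeWeight_append] at h₂
    rw [routeWeight_append, routeWeight_append, add_right_comm]
    exact dvd_add h₂ h₁

theorem forall_closedWeights_dvd_iff (d : ℤ) :
    (∀ n ∈ closedWeights E, d ∣ n) ↔ ∀ n ∈ closedUnrepeatedWeights E, d ∣ n := by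
  constructor
  · rintro h n ⟨hn, u, l, hr, hc, -, hw⟩
    exact h n ⟨hn, u, l, hr, hc, hw⟩
  · rintro h n ⟨-, u, l, hr, hc, rfl⟩
    exact dvd_routeWeight_of_dvd_unrepeated h u l hr hc

end Routes

/-- the gcd of the positive weights of closed routes equals the gcd of
the positive weights of closed unrepeated routes. -/
theorem setGcd_closed_eq_setGcd_unrepeated {V : Type*} [Fintype V]
    (E : V → V → Prop) (g : ℤ) :
    IsSetGcd (closedWeights E) g ↔ IsSetGcd (closedUnrepeatedWeights E) g := by
  simp only [IsSetGcd, forall_closedWeights_dvd_iff]
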